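/- Let A be a symmetric positive definite real 3×3 matrix, u ∈ ℝ³ a unit vector, γ, k_R, k_ω, k_θ, k_ζ, ϱ > 0, J a symmetric positive definite 3×3 matrix, and Σ a 3×3 matrix with Σᵀ = −Σ. Set c_R := ‖Ā‖_F and c_θ := ‖Ā‖_F + 2λ_M^Ā, and suppose k_ζ > max{k_R(1 + ϱc_R)²/(ϱ k_ω), c_θ² k_θ ϱ}. Let R : ℝ → ℝ^{3×3}, θ : ℝ → ℝ, ω, ζ : ℝ → ℝ³, t₀ ∈ ℝ with R(t₀) ∈ SO(3); write values at t₀ with subscript 0 and define Ψ(t) := Ra(θ(t),u)·ψ(A·T(R(t),θ(t))). Suppose at t₀: R has derivative R₀·ω₀^×; θ has derivative −k_θ(γθ₀ + 2uᵀψ(A·T(R₀,θ₀))); ω has derivative J⁻¹(Σω₀ − 2k_R ζ₀ − k_ω ω₀); and ζ has derivative −k_ζ(ζ₀ − Ψ(t₀)). Then the function t ↦ k_R(U(R(t),θ(t)) + ϱ‖ζ(t) − Ψ(t)‖²) + (1/2)ω(t)ᵀJω(t) has a derivative d at t₀ with d ≤ 0. -/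

import Mathlib

open Matrix

noncomputable section

abbrev M3 : Type := Matrix (Fin 3) (Fin 3) ℝ
abbrev V3 : Type := Fin 3 → ℝ

/-- skew-symmetric matrix associated to `x`: `skew x *ᵥ y = x ×₃ y`. -/
def skew (x : V3) : M3 :=
  !![0, -x 2, x 1; x 2, 0, -x 0; -x 1, x 0, 0]

/-- the special orthogonal group SO(3) as a subset of 3×3 matrices -/
def SO3 : Set M3 := {R | Rᵀ * R = 1 ∧ R.det = 1}

/-- Rodrigues formula -/
def Ra (θ : ℝ) (u : V3) : M3 :=
  1 + Real.sin θ • skew u + (1 - Real.cos θ) • (skew u * skew u)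

/-- `psi M = vec (P_a M)`, the vector part of the antisymmetric projection -/
def psi (M : M3) : V3 :=
  ![(M 2 1 - M 1 2) / 2, (M 0 2 - M 2 0) / 2, (M 1 0 - M 0 1) / 2]

/-- the angular-warping transformation `T(R,θ) = R · Ra(θ,u)` -/
def Tmap (u : V3) (R : M3) (θ : ℝ) : M3 := R * Ra θ u

/-- the potential function `U(R,θ)` on SO(3) × ℝ -/
def Ufun (A : M3) (u : V3) (γ : ℝ) (R : M3) (θ : ℝ) : ℝ :=
  (A * (1 - Tmap u R θ)).trace + γ / 2 * θ ^ 2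

/-- Euclidean norm on ℝ³ -/
def enorm3 (x : V3) : ℝ := Real.sqrt (x ⬝ᵥ x)

/-- Frobenius norm of a 3×3 matrix -/
def fnorm (M : M3) : ℝ := Real.sqrt ((Mᵀ * M).trace)

/-- `E(M) := (tr(M) I − Mᵀ)/2` -/
def Emap (M : M3) : M3 := (2⁻¹ : ℝ) • (M.trace • (1 : M3) - Mᵀ)

/-- `D_R(R,θ)` from Lemma 2 -/
def DR (A : M3) (u : V3) (R : M3) (θ : ℝ) : M3 :=
  Ra θ u * Emap (A * Tmap u R θ) * (Ra θ u)ᵀ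

/-- `D_θ(R,θ)` from Lemma 2 -/
def Dθ (A : M3) (u : V3) (R : M3) (θ : ℝ) : V3 :=
  (Ra θ u * Emap (A * Tmap u R θ)) *ᵥ u - skew (Ra θ u *ᵥ psi (A * Tmap u R θ)) *ᵥ u

/-- Δ(v,u) from the construction of the synergistic gap -/
def Delta (A : M3) (v u : V3) : ℝ :=
  u ⬝ᵥ ((A.trace • (1 : M3) - A - (2 * (v ⬝ᵥ A *ᵥ v)) • ((1 : M3) - vecMulVec v v)) *ᵥ u)

/-- `v` is a unit eigenvector of `A` -/
def IsUnitEigen (A : M3) (v : V3) : Prop :=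
  v ⬝ᵥ v = 1 ∧ ∃ lam : ℝ, A *ᵥ v = lam • v

/-- Ā := (tr(A) I − A)/2 -/
def Abar (A : M3) : M3 := (2⁻¹ : ℝ) • (A.trace • (1 : M3) - A)

/-- `lam` is an eigenvalue of `M` -/
def IsEigen (M : M3) (lam : ℝ) : Prop := ∃ w : V3, w ≠ 0 ∧ M *ᵥ w = lam • w
attribute [local instance] Matrix.normedAddCommGroup Matrix.normedSpace


section Calculus

variable {m n : ℝ → V3} {m' n' : V3} {M N : ℝ → M3} {M' N' : M3} {t : ℝ}

theorem hasDerivAt_matrix_iff :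
    HasDerivAt M M' t ↔ ∀ i j, HasDerivAt (fun s => M s i j) (M' i j) t :=
  hasDerivAt_pi.trans (forall_congr' fun _ => hasDerivAt_pi)

theorem HasDerivAt.matrix_mul (hM : HasDerivAt M M' t) (hN : HasDerivAt N N' t) :
    HasDerivAt (fun s => M s * N s) (M' * N t + M t * N') t := by
  rw [hasDerivAt_matrix_iff] at *
  intro i j
  simp only [Matrix.mul_apply, Matrix.add_apply, ← Finset.sum_add_distrib]
  exact HasDerivAt.fun_sum fun k _ => (hM i k).mul (hN k j)

theorem HasDerivAt.matrix_mulVec (hM : HasDerivAt M M' t) (hn : HasDerivAt n n' t) :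
    HasDerivAt (fun s => M s *ᵥ n s) (M' *ᵥ n t + M t *ᵥ n') t := by
  rw [hasDerivAt_matrix_iff] at hM
  rw [hasDerivAt_pi] at *
  intro i
  simp only [mulVec, dotProduct, Pi.add_apply, ← Finset.sum_add_distrib]
  exact HasDerivAt.fun_sum fun k _ => (hM i k).mul (hn k)

theorem HasDerivAt.matrix_dotProduct (hm : HasDerivAt m m' t) (hn : HasDerivAt n n' t) :
    HasDerivAt (fun s => m s ⬝ᵥ n s) (m' ⬝ᵥ n t + m t ⬝ᵥ n') t := by
  rw [hasDerivAt_pi] at *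
  simp only [dotProduct, ← Finset.sum_add_distrib]
  exact HasDerivAt.fun_sum fun k _ => (hm k).mul (hn k)

theorem HasDerivAt.matrix_trace (hM : HasDerivAt M M' t) :
    HasDerivAt (fun s => (M s).trace) M'.trace t := by
  rw [hasDerivAt_matrix_iff] at hM
  exact HasDerivAt.fun_sum fun k _ => hM k k

theorem HasDerivAt.psi (hM : HasDerivAt M M' t) :
    HasDerivAt (fun s => psi (M s)) (psi M') t := by
  rw [hasDerivAt_matrix_iff] at hM
  rw [hasDerivAt_pi]
  intro i
  fin_cases i
  · exact ((hM 2 1).sub (hM 1 2)).div_const 2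
  · exact ((hM 0 2).sub (hM 2 0)).div_const 2
  · exact ((hM 1 0).sub (hM 0 1)).div_const 2

end Calculus

section Skew

theorem skew_add (x y : V3) : skew (x + y) = skew x + skew y := by
  ext i j
  fin_cases i <;> fin_cases j <;> simp [skew] <;> ring

theorem skew_smul (c : ℝ) (x : V3) : skew (c • x) = c • skew x := by
  ext i j
  fin_cases i <;> fin_cases j <;> simp [skew]

theorem transpose_skew (x : V3) : (skew x)ᵀ = -skew x := by
  ext i j
  fin_cases i <;> fin_cases j <;> simp [skew]

theorem skew_mul_self (x : V3) : skew x * skew x = vecMulVec x x - (x ⬝ᵥ x) • 1 := by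
  ext i j
  fin_cases i <;> fin_cases j <;>
    simp [skew, mul_apply, Fin.sum_univ_three, vecMulVec_apply, dotProduct, one_apply] <;> ring

theorem skew_mulVec_self (x : V3) : skew x *ᵥ x = 0 := by
  ext i
  fin_cases i <;> simp [skew, mulVec, dotProduct, Fin.sum_univ_three] <;> ring

theorem skew_mul_skew_mul_skew (x : V3) :
    skew x * (skew x * skew x) = -(x ⬝ᵥ x) • skew x := by
  rw [skew_mul_self, mul_sub, mul_vecMulVec, skew_mulVec_self]
  simp

theorem skew_mulVec_dotProduct_self (x y : V3) :
    skew x *ᵥ y ⬝ᵥ skew x *ᵥ y = (x ⬝ᵥ x) * (y ⬝ᵥ y) - (x ⬝ᵥ y) ^ 2 := by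
  simp [skew, mulVec, dotProduct, Fin.sum_univ_three]
  ring

theorem trace_mul_skew (M : M3) (x : V3) : (M * skew x).trace = -2 * (psi M ⬝ᵥ x) := by
  simp [psi, skew, mul_apply, trace, dotProduct, Fin.sum_univ_three]
  ring

theorem psi_mul_skew (M : M3) (x : V3) : psi (M * skew x) = Emap M *ᵥ x := by
  ext i
  fin_cases i <;>
    simp [psi, skew, Emap, mul_apply, trace, mulVec, dotProduct, Fin.sum_univ_three, one_apply] <;>
    ring

theorem transpose_mul_skew_mulVec_mul (M : M3) (x : V3) :
    Mᵀ * skew (M *ᵥ x) * M = M.det • skew x := by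
  ext i j
  fin_cases i <;> fin_cases j <;>
    simp [skew, mul_apply, mulVec, dotProduct, Fin.sum_univ_three, det_fin_three] <;> ring

end Skew

section Rodrigues

variable {u : V3}

theorem transpose_Ra_mul_self (hu : u ⬝ᵥ u = 1) (θ : ℝ) : (Ra θ u)ᵀ * Ra θ u = 1 := by
  have h3 : skew u * (skew u * skew u) = -skew u := by simp [skew_mul_skew_mul_skew, hu]
  have hsc := Real.sin_sq_add_cos_sq θ
  simp only [Ra, transpose_add, transpose_smul, transpose_mul, transpose_skew, transpose_one,
    add_mul, mul_add, smul_mul_assoc, mul_smul_comm, mul_assoc, one_mul, mul_one,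
    smul_add, neg_mul, mul_neg, neg_neg, smul_neg, h3]
  linear_combination (norm := module) (-hsc) • (skew u * skew u)

theorem Ra_mul_transpose_self (hu : u ⬝ᵥ u = 1) (θ : ℝ) : Ra θ u * (Ra θ u)ᵀ = 1 :=
  mul_eq_one_comm.mp (transpose_Ra_mul_self hu θ)

theorem det_Ra (hu : u ⬝ᵥ u = 1) (θ : ℝ) : (Ra θ u).det = 1 := by
  have hsc := Real.sin_sq_add_cos_sq θ
  have h : (Ra θ u).det =
      (1 - (1 - Real.cos θ) * (u ⬝ᵥ u)) ^ 2 + Real.sin θ ^ 2 * (u ⬝ᵥ u) := by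
    simp [Ra, skew, det_fin_three, Fin.sum_univ_three, dotProduct, one_apply]
    ring
  rw [h, hu]
  linear_combination hsc

theorem skew_mul_Ra (hu : u ⬝ᵥ u = 1) (θ : ℝ) (x : V3) :
    skew x * Ra θ u = Ra θ u * skew ((Ra θ u)ᵀ *ᵥ x) := by
  have h := transpose_mul_skew_mulVec_mul (Ra θ u) ((Ra θ u)ᵀ *ᵥ x)
  rw [mulVec_mulVec, Ra_mul_transpose_self hu, one_mulVec, det_Ra hu, one_smul] at h
  rw [← h, ← mul_assoc, ← mul_assoc, Ra_mul_transpose_self hu, one_mul]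

theorem HasDerivAt.Ra (hu : u ⬝ᵥ u = 1) {θ : ℝ → ℝ} {θ' t : ℝ} (hθ : HasDerivAt θ θ' t) :
    HasDerivAt (fun s => Ra (θ s) u) (θ' • (Ra (θ t) u * skew u)) t := by
  have h3 : skew u * (skew u * skew u) = -skew u := by simp [skew_mul_skew_mul_skew, hu]
  have h := ((hasDerivAt_const t (1 : M3)).add (hθ.sin.smul_const (skew u))).add
    (((hasDerivAt_const t (1 : ℝ)).sub hθ.cos).smul_const (skew u * skew u))
  refine h.congr_deriv ?_
  simp only [_root_.Ra, add_mul, smul_mul_assoc, mul_assoc, h3, one_mul]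
  module

theorem HasDerivAt.Tmap (hu : u ⬝ᵥ u = 1) {R : ℝ → M3} {θ : ℝ → ℝ} {x : V3} {θ' t : ℝ}
    (hR : HasDerivAt R (R t * skew x) t) (hθ : HasDerivAt θ θ' t) :
    HasDerivAt (fun s => Tmap u (R s) (θ s))
      (Tmap u (R t) (θ t) * skew ((_root_.Ra (θ t) u)ᵀ *ᵥ x + θ' • u)) t := by
  refine (hR.matrix_mul (hθ.Ra hu)).congr_deriv ?_
  rw [mul_assoc, skew_mul_Ra hu, skew_add, skew_smul, _root_.Tmap]
  simp only [mul_add, mul_smul_comm, mul_assoc]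

theorem transpose_Tmap_mul_self (hu : u ⬝ᵥ u = 1) {R : M3} (hR : Rᵀ * R = 1) (θ : ℝ) :
    (Tmap u R θ)ᵀ * Tmap u R θ = 1 := by
  rw [Tmap, transpose_mul, mul_assoc, ← mul_assoc Rᵀ, hR, one_mul, transpose_Ra_mul_self hu]

end Rodrigues

section Norms

theorem dotProduct_self_nonneg' (x : V3) : 0 ≤ x ⬝ᵥ x :=
  Finset.sum_nonneg fun i _ => mul_self_nonneg (x i)

theorem sq_enorm3 (x : V3) : enorm3 x ^ 2 = x ⬝ᵥ x :=
  Real.sq_sqrt (dotProduct_self_nonneg' x)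

theorem enorm3_nonneg (x : V3) : 0 ≤ enorm3 x := Real.sqrt_nonneg _

theorem fnorm_nonneg (M : M3) : 0 ≤ fnorm M := Real.sqrt_nonneg _

theorem sq_fnorm (M : M3) : fnorm M ^ 2 = (Mᵀ * M).trace := by
  refine Real.sq_sqrt (Finset.sum_nonneg fun i _ => ?_)
  exact dotProduct_self_nonneg' (M.col i)

theorem abs_dotProduct_le (x y : V3) : |x ⬝ᵥ y| ≤ enorm3 x * enorm3 y := by
  refine abs_le_of_sq_le_sq ?_ (mul_nonneg (enorm3_nonneg x) (enorm3_nonneg y))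
  rw [mul_pow, sq_enorm3, sq_enorm3]
  simpa [dotProduct, sq] using Finset.sum_mul_sq_le_sq_mul_sq Finset.univ x y

theorem enorm3_mulVec_le (M : M3) (x : V3) : enorm3 (M *ᵥ x) ≤ fnorm M * enorm3 x := by
  refine le_of_sq_le_sq ?_ (mul_nonneg (fnorm_nonneg M) (enorm3_nonneg x))
  rw [mul_pow, sq_enorm3, sq_enorm3, sq_fnorm]
  simp only [trace, diag_apply, Matrix.mul_apply, transpose_apply]
  rw [Finset.sum_comm, Finset.sum_mul]
  refine Finset.sum_le_sum fun i _ => ?_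
  simpa [mulVec, dotProduct, sq] using Finset.sum_mul_sq_le_sq_mul_sq Finset.univ (M i) x

theorem enorm3_add_le (x y : V3) : enorm3 (x + y) ≤ enorm3 x + enorm3 y := by
  refine le_of_sq_le_sq ?_ (add_nonneg (enorm3_nonneg x) (enorm3_nonneg y))
  rw [sq_enorm3, add_sq, sq_enorm3, sq_enorm3, add_dotProduct, dotProduct_add, dotProduct_add,
    dotProduct_comm y x]
  linarith [le_of_abs_le (abs_dotProduct_le x y)]

theorem enorm3_skew_mulVec_le (x y : V3) : enorm3 (skew x *ᵥ y) ≤ enorm3 x * enorm3 y := by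
  refine le_of_sq_le_sq ?_ (mul_nonneg (enorm3_nonneg x) (enorm3_nonneg y))
  rw [mul_pow, sq_enorm3, sq_enorm3, sq_enorm3, skew_mulVec_dotProduct_self]
  linarith [sq_nonneg (x ⬝ᵥ y)]

theorem enorm3_mulVec_of_orthogonal {Q : M3} (hQ : Qᵀ * Q = 1) (x : V3) :
    enorm3 (Q *ᵥ x) = enorm3 x := by
  rw [enorm3, enorm3, dotProduct_mulVec, vecMul_mulVec, hQ, vecMul_one]

end Norms

section Bounds

variable {A T : M3}

theorem trace_mul_mul_transpose_nonneg (hA : A.PosSemidef) (B : M3) :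
    0 ≤ (A * (B * Bᵀ)).trace := by
  have h := (hA.conjTranspose_mul_mul_same B).trace_nonneg
  rwa [conjTranspose_eq_transpose_of_trivial, mul_assoc, trace_mul_comm, mul_assoc] at h

theorem trace_mul_transpose_of_posSemidef (hA : A.PosSemidef) (B : M3) :
    (A * Bᵀ).trace = (A * B).trace := by
  have hAt : Aᵀ = A := by simpa using hA.1.eq
  rw [← trace_transpose, transpose_mul, transpose_transpose, hAt, trace_mul_comm]

theorem abs_trace_mul_le_of_orthogonal (hA : A.PosSemidef) (hT : Tᵀ * T = 1) :
    |(A * T).trace| ≤ A.trace := by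
  have hT' : T * Tᵀ = 1 := mul_eq_one_comm.mp hT
  have hsymm := trace_mul_transpose_of_posSemidef hA T
  have h₁ := trace_mul_mul_transpose_nonneg hA (1 + T)
  have h₂ := trace_mul_mul_transpose_nonneg hA (1 - T)
  simp only [transpose_add, transpose_sub, transpose_one, add_mul, mul_add, sub_mul, mul_sub,
    one_mul, mul_one, hT', trace_add, trace_sub, hsymm] at h₁ h₂
  rw [abs_le]
  constructor <;> linarith

theorem four_mul_trace_transpose_Emap_mul_self (M : M3) :
    4 * ((Emap M)ᵀ * Emap M).trace = M.trace ^ 2 + (Mᵀ * M).trace := by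
  simp [Emap, mul_apply, trace, Fin.sum_univ_three, one_apply]
  ring

theorem Abar_eq_Emap (hA : A.PosSemidef) : Abar A = Emap A := by
  have hAt : Aᵀ = A := by simpa using hA.1.eq
  rw [Abar, Emap, hAt]

theorem fnorm_Emap_mul_le (hA : A.PosSemidef) (hT : Tᵀ * T = 1) :
    fnorm (Emap (A * T)) ≤ fnorm (Abar A) := by
  have hT' : T * Tᵀ = 1 := mul_eq_one_comm.mp hT
  have h₁ := four_mul_trace_transpose_Emap_mul_self (A * T)
  have h₂ := four_mul_trace_transpose_Emap_mul_self A
  have h₃ : ((A * T)ᵀ * (A * T)).trace = (Aᵀ * A).trace := by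
    rw [transpose_mul, mul_assoc, trace_mul_comm, mul_assoc, mul_assoc, hT', mul_one]
  have h₄ := sq_le_sq' (neg_le_of_abs_le (abs_trace_mul_le_of_orthogonal hA hT))
    (le_of_abs_le (abs_trace_mul_le_of_orthogonal hA hT))
  rw [Abar_eq_Emap hA]
  refine Real.sqrt_le_sqrt ?_
  linarith

theorem two_mul_enorm3_psi_mul_le (hA : A.PosSemidef) (hT : Tᵀ * T = 1) :
    2 * enorm3 (psi (A * T)) ≤ A.trace := by
  have hT' : T * Tᵀ = 1 := mul_eq_one_comm.mp hT
  set x := psi (A * T)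
  set s := enorm3 x with hs
  rcases (enorm3_nonneg x).eq_or_lt with h0 | h0
  · rw [hs, ← h0, mul_zero]
    exact hA.trace_nonneg
  have hss : s ^ 2 = x ⬝ᵥ x := sq_enorm3 x
  have h₁ := trace_mul_mul_transpose_nonneg hA (s • 1 + T * skew x)
  have hsymm := trace_mul_transpose_of_posSemidef hA (T * skew x)
  have h₂ : (A * (T * skew x)).trace = -2 * s ^ 2 := by
    rw [← mul_assoc, trace_mul_skew, hss]
  have h₃ : (T * skew x) * (T * skew x)ᵀ = s ^ 2 • 1 - vecMulVec (T *ᵥ x) (T *ᵥ x) := by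
    rw [transpose_mul, transpose_skew, mul_assoc, ← mul_assoc (skew x), mul_neg, skew_mul_self,
      ← hss]
    simp [sub_mul, mul_sub, mul_vecMulVec, vecMulVec_mul, vecMul_transpose, hT']
  have h₄ : 0 ≤ (A * vecMulVec (T *ᵥ x) (T *ᵥ x)).trace := by
    rw [mul_vecMulVec, trace_vecMulVec, dotProduct_comm]
    simpa using hA.dotProduct_mulVec_nonneg (T *ᵥ x)
  have h₅ : (A * ((s • 1 + T * skew x) * (s • 1 + T * skew x)ᵀ)).trace =
      2 * s ^ 2 * A.trace - 4 * s ^ 3 - (A * vecMulVec (T *ᵥ x) (T *ᵥ x)).trace := by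
    rw [transpose_add, add_mul, mul_add, mul_add (T * skew x), h₃]
    simp only [transpose_smul, transpose_one, smul_mul_assoc, mul_smul_comm, one_mul, mul_one,
      mul_add, mul_sub, trace_add, trace_sub, trace_smul, hsymm, h₂, smul_eq_mul]
    ring
  have h₆ : 0 ≤ 2 * s ^ 2 * (A.trace - 2 * s) := by linarith
  have h₇ := nonneg_of_mul_nonneg_right h₆ (by positivity)
  linarith

theorem trace_le_three_mul_of_isEigen_le {M : M3} (hM : M.IsHermitian) {c : ℝ}
    (hc : ∀ l : ℝ, IsEigen M l → l ≤ c) : M.trace ≤ 3 * c := by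
  have h : ∀ i, hM.eigenvalues i ≤ c := fun i => by
    refine hc _ ⟨(hM.eigenvectorBasis i).ofLp, fun h => ?_, hM.mulVec_eigenvectorBasis i⟩
    exact hM.eigenvectorBasis.toBasis.ne_zero i (by ext j; simpa using congrFun h j)
  rw [hM.trace_eq_sum_eigenvalues, Fin.sum_univ_three]
  have h0 := h 0
  have h1 := h 1
  have h2 := h 2
  simp only [RCLike.ofReal_real_eq_id, id]
  linarith

theorem trace_Abar (A : M3) : (Abar A).trace = A.trace := by
  simp [Abar, trace, Fin.sum_univ_three, one_apply]
  ring

theorem isHermitian_Abar (hA : A.IsHermitian) : (Abar A).IsHermitian := by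
  have hAt : Aᵀ = A := by simpa using hA.eq
  simp [IsHermitian, Abar, hAt]

theorem enorm3_psi_mul_le (hA : A.PosSemidef) (hT : Tᵀ * T = 1) {c : ℝ}
    (hc : ∀ l : ℝ, IsEigen (Abar A) l → l ≤ c) : enorm3 (psi (A * T)) ≤ 2 * c := by
  have h₁ := trace_le_three_mul_of_isEigen_le (isHermitian_Abar hA.1) hc
  have h₂ := two_mul_enorm3_psi_mul_le hA hT
  have h₃ := hA.trace_nonneg
  rw [trace_Abar] at h₁
  linarith

end Bounds

section Gains

/-- Two applications of Young's inequality absorbing the cross terms of the Lyapunov derivative. -/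
theorem cross_terms_le {kR kω kθ kζ ϱ cR cθ e w g : ℝ} (hkR : 0 < kR) (hkω : 0 < kω)
    (hkθ : 0 < kθ) (hϱ : 0 < ϱ)
    (hkζ : max (kR * (1 + ϱ * cR) ^ 2 / (ϱ * kω)) (cθ ^ 2 * kθ * ϱ) < kζ) :
    2 * kR * (1 + ϱ * cR) * (e * w) + 2 * kR * ϱ * kθ * cθ * (g * e) ≤
      kω * w ^ 2 + kR * kθ * g ^ 2 + 2 * kR * ϱ * kζ * e ^ 2 := by
  obtain ⟨h₁, h₂⟩ := max_lt_iff.mp hkζ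
  rw [div_lt_iff₀ (by positivity)] at h₁
  have h₃ : 2 * kR * ϱ * kθ * cθ * (g * e) ≤ kR * kθ * g ^ 2 + kR * ϱ * kζ * e ^ 2 := by
    nlinarith [mul_nonneg (mul_pos hkR hkθ).le (sq_nonneg (g - ϱ * cθ * e)),
      mul_le_mul_of_nonneg_left h₂.le (mul_nonneg (mul_pos hkR hϱ).le (sq_nonneg e))]
  have h₄ : 2 * kR * (1 + ϱ * cR) * (e * w) ≤ kω * w ^ 2 + kR * ϱ * kζ * e ^ 2 := by
    refine le_of_mul_le_mul_left ?_ hkω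
    nlinarith [sq_nonneg (kω * w - kR * (1 + ϱ * cR) * e),
      mul_le_mul_of_nonneg_left h₁.le (mul_nonneg hkR.le (sq_nonneg e))]
  linarith

end Gains

theorem lyapunov_decrease_smooth
    (A : M3) (hA : A.PosDef) (u : V3) (hu : u ⬝ᵥ u = 1)
    (γ kR kω kθ kζ ϱ : ℝ) (hγ : 0 < γ) (hkR : 0 < kR) (hkω : 0 < kω) (hkθ : 0 < kθ)
    (hkζpos : 0 < kζ) (hϱ : 0 < ϱ)
    (J : M3) (hJ : J.PosDef) (Sm : M3) (hSm : Smᵀ = -Sm)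
    (lamM : ℝ) (hM : IsEigen (Abar A) lamM)
    (hbound : ∀ lam : ℝ, IsEigen (Abar A) lam → lam ≤ lamM)
    (cR cθ : ℝ) (hcR : cR = fnorm (Abar A)) (hcθ : cθ = fnorm (Abar A) + 2 * lamM)
    (hkζ : kζ > max (kR * (1 + ϱ * cR) ^ 2 / (ϱ * kω)) (cθ ^ 2 * kθ * ϱ))
    (R : ℝ → M3) (θ : ℝ → ℝ) (ω ζ : ℝ → V3) (t₀ : ℝ) (hR0 : R t₀ ∈ SO3)
    (Ψ : ℝ → V3) (hΨ : ∀ t, Ψ t = Ra (θ t) u *ᵥ psi (A * Tmap u (R t) (θ t)))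
    (hR : HasDerivAt R (R t₀ * skew (ω t₀)) t₀)
    (hθ : HasDerivAt θ
      (-(kθ * (γ * θ t₀ + 2 * (u ⬝ᵥ psi (A * Tmap u (R t₀) (θ t₀)))))) t₀)
    (hω : HasDerivAt ω (J⁻¹ *ᵥ (Sm *ᵥ ω t₀ - (2 * kR) • ζ t₀ - kω • ω t₀)) t₀)
    (hζ : HasDerivAt ζ (-kζ • (ζ t₀ - Ψ t₀)) t₀) :
    ∃ d : ℝ,
      HasDerivAt
        (fun t => kR * (Ufun A u γ (R t) (θ t) + ϱ * ((ζ t - Ψ t) ⬝ᵥ (ζ t - Ψ t))) +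
          1 / 2 * (ω t ⬝ᵥ J *ᵥ ω t)) d t₀ ∧ d ≤ 0 := by
  have hA' := hA.posSemidef
  have hT := transpose_Tmap_mul_self hu hR0.1 (θ t₀)
  have hQ := Ra_mul_transpose_self hu (θ t₀)
  have hJt : Jᵀ = J := by simpa using hJ.1.eq
  have hJinv : J * J⁻¹ = 1 := mul_nonsing_inv J hJ.det_pos.ne'.isUnit
  have hEb := hcR ▸ fnorm_Emap_mul_le hA' hT
  have hψb := enorm3_psi_mul_le hA' hT hbound
  have hT' := hR.Tmap hu hθ
  have hP' := (hasDerivAt_const t₀ A).matrix_mul hT'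
  have hψ' := hP'.psi
  have hΨ' := (hθ.Ra hu).matrix_mulVec hψ'
  rw [zero_mul, zero_add, ← mul_assoc, psi_mul_skew] at hΨ'
  rw [← funext hΨ] at hΨ'
  have hU' := ((hasDerivAt_const t₀ A).matrix_mul (hT'.const_sub 1)).matrix_trace.add
    ((hθ.pow 2).const_mul (γ / 2))
  rw [zero_mul, zero_add, mul_neg, trace_neg, ← mul_assoc, trace_mul_skew] at hU'
  have he' := hζ.sub hΨ'
  have hJω' := (hasDerivAt_const t₀ J).matrix_mulVec hω
  rw [zero_mulVec, zero_add, mulVec_mulVec, hJinv, one_mulVec] at hJω'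
  refine ⟨_, ((hU'.add ((he'.matrix_dotProduct he').const_mul ϱ)).const_mul kR).add
    ((hω.matrix_dotProduct hJω').const_mul (1 / 2)), ?_⟩
  have hJω : (J⁻¹ *ᵥ (Sm *ᵥ ω t₀ - (2 * kR) • ζ t₀ - kω • ω t₀)) ⬝ᵥ J *ᵥ ω t₀ =
      ω t₀ ⬝ᵥ (Sm *ᵥ ω t₀ - (2 * kR) • ζ t₀ - kω • ω t₀) := by
    rw [dotProduct_mulVec, ← mulVec_transpose, hJt, mulVec_mulVec, hJinv, one_mulVec,
      dotProduct_comm]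
  have hSω : ω t₀ ⬝ᵥ Sm *ᵥ ω t₀ = 0 := by
    have h := dotProduct_mulVec (ω t₀) Sm (ω t₀)
    rw [← mulVec_transpose, hSm, neg_mulVec, neg_dotProduct, dotProduct_comm (Sm *ᵥ ω t₀)] at h
    linarith
  have hΨω : psi (A * Tmap u (R t₀) (θ t₀)) ⬝ᵥ (Ra (θ t₀) u)ᵀ *ᵥ ω t₀ = Ψ t₀ ⬝ᵥ ω t₀ := by
    rw [hΨ, dotProduct_mulVec, vecMul_transpose]
  rw [hJω]
  simp only [Pi.sub_apply]
  set g := γ * θ t₀ + 2 * (u ⬝ᵥ psi (A * Tmap u (R t₀) (θ t₀))) with hg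
  set E := Emap (A * Tmap u (R t₀) (θ t₀))
  set p := psi (A * Tmap u (R t₀) (θ t₀))
  set Q := Ra (θ t₀) u
  have hωe : ω t₀ ⬝ᵥ ζ t₀ = ω t₀ ⬝ᵥ (ζ t₀ - Ψ t₀) + Ψ t₀ ⬝ᵥ ω t₀ := by
    rw [dotProduct_sub, dotProduct_comm (Ψ t₀)]
    ring
  set e := ζ t₀ - Ψ t₀
  have hQe : enorm3 (Qᵀ *ᵥ e) = enorm3 e :=
    enorm3_mulVec_of_orthogonal (by rwa [transpose_transpose]) e
  have hQω : enorm3 (Qᵀ *ᵥ ω t₀) = enorm3 (ω t₀) :=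
    enorm3_mulVec_of_orthogonal (by rwa [transpose_transpose]) _
  have hu1 : enorm3 u = 1 := by rw [enorm3, hu, Real.sqrt_one]
  have hΨe : e ⬝ᵥ (((-(kθ * g)) • (Q * skew u)) *ᵥ p + Q *ᵥ E *ᵥ (Qᵀ *ᵥ ω t₀ + (-(kθ * g)) • u)) =
      Qᵀ *ᵥ e ⬝ᵥ E *ᵥ Qᵀ *ᵥ ω t₀ - kθ * g * (Qᵀ *ᵥ e ⬝ᵥ (skew u *ᵥ p + E *ᵥ u)) := by
    rw [smul_mulVec, ← mulVec_mulVec, ← mulVec_smul, ← mulVec_add, dotProduct_mulVec, ← mulVec_transpose]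
    simp only [mulVec_add, mulVec_smul, dotProduct_add, dotProduct_smul, smul_eq_mul]
    ring
  have hDR : |Qᵀ *ᵥ e ⬝ᵥ E *ᵥ Qᵀ *ᵥ ω t₀| ≤ cR * (enorm3 e * enorm3 (ω t₀)) := by
    calc _ ≤ enorm3 e * (fnorm E * enorm3 (ω t₀)) := by
          rw [← hQe, ← hQω]
          exact (abs_dotProduct_le _ _).trans
            (mul_le_mul_of_nonneg_left (enorm3_mulVec_le _ _) (enorm3_nonneg _))
      _ ≤ enorm3 e * (cR * enorm3 (ω t₀)) := by
          gcongr
          exacts [enorm3_nonneg _, enorm3_nonneg _]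
      _ = _ := by ring
  have hDθ : |Qᵀ *ᵥ e ⬝ᵥ (skew u *ᵥ p + E *ᵥ u)| ≤ cθ * enorm3 e := by
    have h₁ := enorm3_add_le (skew u *ᵥ p) (E *ᵥ u)
    have h₂ := enorm3_skew_mulVec_le u p
    have h₃ := enorm3_mulVec_le E u
    rw [hu1] at h₂ h₃
    have h₄ : enorm3 (skew u *ᵥ p + E *ᵥ u) ≤ cθ := by linarith
    rw [← hQe, mul_comm]
    exact (abs_dotProduct_le _ _).trans (mul_le_mul_of_nonneg_left h₄ (enorm3_nonneg _))
  have hgDθ : kθ * g * (Qᵀ *ᵥ e ⬝ᵥ (skew u *ᵥ p + E *ᵥ u)) ≤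
      kθ * |g| * (cθ * enorm3 e) := by
    refine (le_abs_self _).trans ?_
    rw [abs_mul, abs_mul, abs_of_pos hkθ]
    gcongr
  have hcross := cross_terms_le (e := enorm3 e) (w := enorm3 (ω t₀)) (g := |g|)
    hkR hkω hkθ hϱ hkζ
  rw [sq_abs, sq_enorm3, sq_enorm3] at hcross
  have hωe' := abs_le.mp (abs_dotProduct_le (ω t₀) e)
  have hup : p ⬝ᵥ u = u ⬝ᵥ p := dotProduct_comm _ _
  rw [dotProduct_comm _ e, dotProduct_sub e, hΨe, dotProduct_add p]
  simp only [dotProduct_sub, dotProduct_smul, smul_eq_mul, hSω, hΨω, hωe, hup]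
  push_cast
  linear_combination hcross + (2 * kR * ϱ) * hgDθ + (2 * kR * ϱ) * neg_le_of_abs_le hDR +
    (2 * kR) * hωe'.1 + (-(kR * kθ * g)) * hg
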